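/- Let k be an infinite field and let d = 2s be even with d ≥ 2 (so s ≥ 1). For general forms f₁, f₂, f₃ of degree d in R = k[x,y], setting I = (f₁, f₂, f₃), one has dim_k (R/I)_{3s−2} = 2 and dim_k (R/I)_{3s−1} = 0, where (R/I)_j denotes the degree-j graded piece of R/I. -/

import Mathlib

open MvPolynomial

noncomputable section

/-- The binary form of degree `d` in `k[x,y]` with coefficient vector `c`
(`x := X 0`, `y := X 1`). -/
def formOf {k : Type*} [Field k] (d : ℕ) (c : Fin (d + 1) → k) :
    MvPolynomial (Fin 2) k :=
  ∑ l : Fin (d + 1), C (c l) * X 0 ^ (l : ℕ) * X 1 ^ (d - (l : ℕ))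

/-- The degree-`j` graded piece of `R/I`, `R = k[x,y]`: the image of the homogeneous
polynomials of degree `j` in the quotient, as a `k`-vector space. -/
def quotPiece {k : Type*} [Field k] (I : Ideal (MvPolynomial (Fin 2) k)) (j : ℕ) :
    Submodule k (MvPolynomial (Fin 2) k ⧸ I) :=
  Submodule.map (Ideal.Quotient.mkₐ k I).toLinearMap (homogeneousSubmodule (Fin 2) k j)

/-- The exponent of the monomial `x ^ l * y ^ (n - 1 - l)`. -/
def binaryExponent (n : ℕ) (l : Fin n) : Fin 2 →₀ ℕ :=
  Finsupp.single 0 (l : ℕ) + Finsupp.single 1 (n - 1 - (l : ℕ))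

theorem binaryExponent_injective (n : ℕ) : Function.Injective (binaryExponent n) := by
  intro l m h
  have := DFunLike.congr_fun h 0
  simpa [binaryExponent, Fin.val_inj] using this

section

variable {k : Type*} [Field k]

/-- The form `∑ b l * x ^ l * y ^ (n - 1 - l)`, which has degree `n - 1` and is zero if `n = 0`. -/
def binaryForm (k : Type*) [Field k] (n : ℕ) : (Fin n → k) →ₗ[k] MvPolynomial (Fin 2) k :=
  Fintype.linearCombination k fun l => monomial (binaryExponent n l) 1

attribute [local instance] MvPolynomial.gradedAlgebra

theorem binaryForm_apply (n : ℕ) (b : Fin n → k) :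
    binaryForm k n b = ∑ l, monomial (binaryExponent n l) (b l) := by
  simp [binaryForm, Fintype.linearCombination_apply, smul_monomial]

theorem binaryForm_eq_formOf (d : ℕ) (c : Fin (d + 1) → k) :
    formOf d c = binaryForm k (d + 1) c := by
  rw [binaryForm_apply, formOf]
  refine Finset.sum_congr rfl fun l _ => ?_
  rw [C_mul_X_pow_eq_monomial, X_pow_eq_monomial, monomial_mul, mul_one]
  rfl

theorem coeff_binaryForm (n : ℕ) (b : Fin n → k) (l : Fin n) :
    coeff (binaryExponent n l) (binaryForm k n b) = b l := by
  simp [binaryForm_apply, coeff_sum, coeff_monomial, (binaryExponent_injective n).eq_iff]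

theorem binaryForm_injective (n : ℕ) : Function.Injective (binaryForm k n) := by
  intro b b' h
  funext l
  rw [← coeff_binaryForm n b l, h, coeff_binaryForm]

theorem binaryForm_isHomogeneous (n : ℕ) (b : Fin (n + 1) → k) :
    (binaryForm k (n + 1) b).IsHomogeneous n := by
  rw [binaryForm_apply]
  refine IsHomogeneous.sum _ _ _ fun l _ => isHomogeneous_monomial _ ?_
  have := l.is_le
  simp only [binaryExponent, map_add, Finsupp.degree_single]
  omega

theorem range_binaryForm (n : ℕ) :
    LinearMap.range (binaryForm k (n + 1)) = homogeneousSubmodule (Fin 2) k n := by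
  apply le_antisymm
  · rintro _ ⟨b, rfl⟩
    exact binaryForm_isHomogeneous n b
  · intro p hp
    refine ⟨fun l => coeff (binaryExponent (n + 1) l) p, ?_⟩
    ext e
    by_cases he : e.degree = n
    · have h2 : e 0 + e 1 = n := by
        simpa [Finsupp.degree_eq_sum, Fin.sum_univ_two] using he
      have : e = binaryExponent (n + 1) ⟨e 0, by omega⟩ := by
        ext i
        fin_cases i
        · simp [binaryExponent]
        · simp [binaryExponent]; omega
      rw [this, coeff_binaryForm]
    · rw [(binaryForm_isHomogeneous n _).coeff_eq_zero he,
        IsHomogeneous.coeff_eq_zero hp he]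

theorem finrank_homogeneousSubmodule_fin_two (n : ℕ) :
    Module.finrank k (homogeneousSubmodule (Fin 2) k n) = n + 1 := by
  rw [← range_binaryForm, LinearMap.finrank_range_of_inj (binaryForm_injective _)]
  simp

instance (n : ℕ) : FiniteDimensional k (homogeneousSubmodule (Fin 2) k n) := by
  rw [← range_binaryForm]
  infer_instance

theorem X_mul_binaryForm (n : ℕ) (b : Fin n → k) :
    X 0 * binaryForm k n b = binaryForm k (n + 1) (Fin.cons 0 b) := by
  simp only [binaryForm_apply, Fin.sum_univ_succ, Fin.cons_zero, Fin.cons_succ, map_zero,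
    zero_add, Finset.mul_sum]
  refine Finset.sum_congr rfl fun l _ => ?_
  rw [X, monomial_mul, one_mul]
  refine congrArg (fun e => monomial e (b l)) ?_
  ext i
  fin_cases i
  · simp [binaryExponent, add_comm]
  · simp [binaryExponent]; omega

/-- The map `(a₀, a₁, a₂) ↦ a₀ f₀ + a₁ f₁ + a₂ f₂` on triples of forms `aᵢ` of degree `n - 1`. -/
def combineForms {d : ℕ} (c : Fin 3 → Fin (d + 1) → k) (n : ℕ) :
    (Fin 3 → Fin n → k) →ₗ[k] MvPolynomial (Fin 2) k :=
  ∑ i, LinearMap.mulRight k (formOf d (c i)) ∘ₗ binaryForm k n ∘ₗ LinearMap.proj i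

theorem combineForms_apply {d : ℕ} (c : Fin 3 → Fin (d + 1) → k) (n : ℕ)
    (b : Fin 3 → Fin n → k) :
    combineForms c n b = ∑ i, binaryForm k n (b i) * formOf d (c i) := by
  simp [combineForms]

theorem combineForms_injective_of_succ {d : ℕ} (c : Fin 3 → Fin (d + 1) → k) (n : ℕ)
    (h : Function.Injective (combineForms c (n + 1))) :
    Function.Injective (combineForms c n) := by
  intro b b' hb
  have key : ∀ b : Fin 3 → Fin n → k,
      combineForms c (n + 1) (fun i => Fin.cons 0 (b i)) = X 0 * combineForms c n b := by
    intro b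
    simp only [combineForms_apply, ← X_mul_binaryForm, Finset.mul_sum, mul_assoc]
  have := h ((key b).trans (hb ▸ (key b').symm))
  funext i
  exact Fin.cons_right_injective (α := fun _ => k) 0 (congrFun this i)

theorem formOf_mem {d : ℕ} (c : Fin (d + 1) → k) :
    formOf d c ∈ homogeneousSubmodule (Fin 2) k d := by
  rw [binaryForm_eq_formOf]
  exact binaryForm_isHomogeneous d c

theorem range_combineForms {d : ℕ} (hd : 1 ≤ d) (c : Fin 3 → Fin (d + 1) → k) (n : ℕ) :
    LinearMap.range (combineForms c n) = homogeneousSubmodule (Fin 2) k (d + n - 1) ⊓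
      (Ideal.span {formOf d (c 0), formOf d (c 1), formOf d (c 2)}).restrictScalars k := by
  apply le_antisymm
  · rintro _ ⟨b, rfl⟩
    rw [combineForms_apply]
    refine ⟨Submodule.sum_mem _ fun i _ => ?_, ?_⟩
    · cases n with
      | zero => simp [binaryForm_apply]
      | succ n =>
        have := (binaryForm_isHomogeneous n (b i)).mul (formOf_mem (c i))
        rwa [show d + (n + 1) - 1 = n + d by omega]
    · refine Ideal.sum_mem _ fun i _ => Ideal.mul_mem_left _ _ (Ideal.subset_span ?_)
      fin_cases i <;> simp
  · rintro p ⟨hp, hpI⟩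
    obtain ⟨a₀, a₁, a₂, rfl⟩ := Submodule.mem_span_triple.1 hpI
    have hdec : ∀ (a : MvPolynomial (Fin 2) k) (i : Fin 3), ∃ b : Fin n → k,
        homogeneousComponent (d + n - 1) (a * formOf d (c i)) =
          binaryForm k n b * formOf d (c i) := by
      intro a i
      rw [← decomposition.decompose'_apply]
      cases n with
      | zero =>
        refine ⟨0, ?_⟩
        rw [map_zero, zero_mul]
        exact DirectSum.coe_decompose_mul_of_right_mem_of_not_le (homogeneousSubmodule (Fin 2) k)
          (formOf_mem (c i)) (by omega)
      | succ n =>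
        obtain ⟨b, hb⟩ : homogeneousComponent n a ∈ LinearMap.range (binaryForm k (n + 1)) := by
          rw [range_binaryForm]
          exact homogeneousComponent_mem _ _
        refine ⟨b, ?_⟩
        rw [hb, show d + (n + 1) - 1 = n + d by omega, ← decomposition.decompose'_apply]
        exact DirectSum.coe_decompose_mul_add_of_right_mem (homogeneousSubmodule (Fin 2) k)
          (formOf_mem (c i))
    obtain ⟨b₀, h₀⟩ := hdec a₀ 0
    obtain ⟨b₁, h₁⟩ := hdec a₁ 1
    obtain ⟨b₂, h₂⟩ := hdec a₂ 2
    refine ⟨![b₀, b₁, b₂], ?_⟩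
    rw [combineForms_apply, Fin.sum_univ_three]
    have := homogeneousComponent_eq_self hp
    simp only [smul_eq_mul, map_add] at this
    simpa [h₀, h₁, h₂] using this

theorem finrank_quotPiece_add {d : ℕ} (hd : 1 ≤ d) (c : Fin 3 → Fin (d + 1) → k) (n : ℕ)
    (h : Function.Injective (combineForms c n)) :
    Module.finrank k (quotPiece (Ideal.span {formOf d (c 0), formOf d (c 1), formOf d (c 2)})
      (d + n - 1)) + 3 * n = d + n := by
  set I := Ideal.span {formOf d (c 0), formOf d (c 1), formOf d (c 2)} with hI
  set H := homogeneousSubmodule (Fin 2) k (d + n - 1) with hH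
  have hrank := LinearMap.finrank_range_add_finrank_ker
    ((Ideal.Quotient.mkₐ k I).toLinearMap.domRestrict H)
  have hker : Module.finrank k
      (LinearMap.ker ((Ideal.Quotient.mkₐ k I).toLinearMap.domRestrict H)) = 3 * n := by
    have hmap : (LinearMap.ker ((Ideal.Quotient.mkₐ k I).toLinearMap.domRestrict H)).map
        H.subtype = LinearMap.range (combineForms c n) := by
      rw [range_combineForms hd]
      ext p
      simp [Ideal.Quotient.eq_zero_iff_mem, ← hI, ← hH, and_comm]
    rw [← Submodule.finrank_map_subtype_eq, hmap, LinearMap.finrank_range_of_inj h]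
    simp [Module.finrank_pi_fintype]
  rw [LinearMap.range_domRestrict, hker, finrank_homogeneousSubmodule_fin_two] at hrank
  rw [quotPiece, hrank]
  omega

/-- The matrix of `combineForms c s` in degree `3 * s - 1`, where the pair `(j, m)` labels the
row of `x ^ (s * j + m)`. -/
def combineMatrix {A : Type*} [CommRing A] {d : ℕ} (s : ℕ) (c : Fin 3 → Fin (d + 1) → A) :
    Matrix (Fin 3 × Fin s) (Fin 3 × Fin s) A :=
  Matrix.of fun a p => ∑ t : Fin (d + 1),
    if (p.2 : ℕ) + t = s * a.1 + a.2 then c p.1 t else 0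

theorem combineMatrix_map {A B : Type*} [CommRing A] [CommRing B] (f : A →+* B) {d : ℕ} (s : ℕ)
    (c : Fin 3 → Fin (d + 1) → A) :
    f.mapMatrix (combineMatrix s c) = combineMatrix s fun i t => f (c i t) := by
  ext a p
  simp [combineMatrix, apply_ite f]

theorem combineMatrix_monomials {A : Type*} [CommRing A] (s : ℕ) :
    combineMatrix (d := 2 * s) s (fun i t => if (t : ℕ) = s * i then (1 : A) else 0) = 1 := by
  ext ⟨j, m⟩ ⟨i, l⟩
  have hi : s * (i : ℕ) < 2 * s + 1 := by nlinarith [i.is_le]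
  have hinj : (l : ℕ) + s * i = s * j + m ↔ (j, m) = (i, l) := by
    rw [← finProdFinEquiv.injective.eq_iff, Fin.ext_iff]
    simp only [finProdFinEquiv_apply_val]
    omega
  simp only [Matrix.one_apply, ← hinj, combineMatrix, Matrix.of_apply]
  rw [Finset.sum_eq_single ⟨s * i, hi⟩]
  · simp
  · intro t _ ht
    simp [Fin.ext_iff] at ht
    simp [ht]
  · simp

theorem combineForms_eq_binaryForm {d : ℕ} (s : ℕ) (hd : d = 2 * s)
    (c : Fin 3 → Fin (d + 1) → k) (b : Fin 3 → Fin s → k) :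
    combineForms c s b = binaryForm k (3 * s) fun a =>
      (combineMatrix s c).mulVec (fun p => b p.1 p.2) (finProdFinEquiv.symm a) := by
  have hterm : ∀ (i : Fin 3) (l : Fin s) (t : Fin (d + 1)),
      (monomial (binaryExponent s l) (b i l) : MvPolynomial (Fin 2) k) *
        monomial (binaryExponent (d + 1) t) (c i t) =
      ∑ a : Fin (3 * s), monomial (binaryExponent (3 * s) a)
        (if (l : ℕ) + t = a then c i t * b i l else 0) := by
    intro i l t
    rw [Finset.sum_eq_single ⟨l + t, by omega⟩]
    · rw [monomial_mul, if_pos rfl, mul_comm]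
      refine congrArg (fun e => monomial e (c i t * b i l)) ?_
      ext e
      fin_cases e
      · simp [binaryExponent]
      · simp [binaryExponent]; omega
    · intro a _ ha
      rw [if_neg fun h => ha (Fin.ext h.symm), map_zero]
    · simp
  have hval : ∀ a : Fin (3 * s),
      s * ((finProdFinEquiv.symm a).1 : ℕ) + ((finProdFinEquiv.symm a).2 : ℕ) = a := by
    intro a
    conv_rhs => rw [← finProdFinEquiv.apply_symm_apply a, finProdFinEquiv_apply_val, add_comm]
  simp only [combineForms_apply, binaryForm_eq_formOf, binaryForm_apply, Finset.sum_mul_sum, hterm]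
  simp only [Matrix.mulVec, dotProduct, combineMatrix, Matrix.of_apply, hval, Finset.sum_mul, ite_mul,
    zero_mul, map_sum, Fintype.sum_prod_type]
  simp only [Finset.sum_comm (s := (Finset.univ : Finset (Fin (3 * s))))]

theorem combineForms_injective {d : ℕ} (s : ℕ) (hd : d = 2 * s) (c : Fin 3 → Fin (d + 1) → k)
    (h : (combineMatrix s c).det ≠ 0) : Function.Injective (combineForms c s) := by
  intro b b' hb
  rw [combineForms_eq_binaryForm s hd, combineForms_eq_binaryForm s hd] at hb
  have hvec := (binaryForm_injective _ hb)
  have hmat := Matrix.mulVec_injective_of_isUnit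
    ((Matrix.isUnit_iff_isUnit_det _).2 (isUnit_iff_ne_zero.2 h))
  have hpairs := hmat (funext fun a => by
    simpa using congrFun hvec (finProdFinEquiv a))
  funext i l
  exact congrFun hpairs (i, l)

end

/-- For an infinite field `k` and even `d = 2s ≥ 2`, for general forms `f₁, f₂, f₃` of
degree `d` in `R = k[x,y]` (genericity encoded as the nonvanishing locus of a nonzero
polynomial on the parameter space `k^{3(d+1)}`), with `I = (f₁,f₂,f₃)`, one has
`dim_k (R/I)_{3s−2} = 2` and `dim_k (R/I)_{3s−1} = 0`. -/
theorem general_binary_forms_even_socle (k : Type*) [Field k] [Infinite k]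
    (s d : ℕ) (hs : 1 ≤ s) (hd : d = 2 * s) :
    ∃ P : MvPolynomial (Fin 3 × Fin (d + 1)) k, P ≠ 0 ∧
      ∀ c : Fin 3 → Fin (d + 1) → k,
        eval (fun p => c p.1 p.2) P ≠ 0 →
          Module.finrank k
            (quotPiece (Ideal.span {formOf d (c 0), formOf d (c 1), formOf d (c 2)}) (3 * s - 2)) = 2 ∧
          Module.finrank k
            (quotPiece (Ideal.span {formOf d (c 0), formOf d (c 1), formOf d (c 2)})
              (3 * s - 1)) = 0 := by
  have heval : ∀ c : Fin 3 → Fin (d + 1) → k,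
      eval (fun p => c p.1 p.2) (combineMatrix s fun i t =>
        (X (i, t) : MvPolynomial (Fin 3 × Fin (d + 1)) k)).det = (combineMatrix s c).det := by
    intro c
    rw [RingHom.map_det, combineMatrix_map]
    simp
  refine ⟨(combineMatrix s fun i t => X (i, t)).det, ?_, fun c hc => ?_⟩
  · intro hzero
    subst hd
    have := heval fun i t => if (t : ℕ) = s * i then 1 else 0
    rw [hzero, combineMatrix_monomials] at this
    simp at this
  · rw [heval] at hc
    have hinj := combineForms_injective s hd c hc
    obtain ⟨n, rfl⟩ : ∃ n, s = n + 1 := ⟨s - 1, by omega⟩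
    have hsocle := finrank_quotPiece_add (by omega) c _ (combineForms_injective_of_succ c n hinj)
    have htop := finrank_quotPiece_add (by omega) c _ hinj
    rw [show 3 * (n + 1) - 2 = d + n - 1 by omega,
      show 3 * (n + 1) - 1 = d + (n + 1) - 1 by omega]
    omega
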